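/- Suppose c₂ > 0. Then inf over Q ∈ 𝒜 of f_s(Q, ν) equals inf over x ∈ ℝ³ of f̃_s(x, ν), where f̃_s(x, ν) := c₁(x·ν) + (c₃ − c₂/2)(x·ν)² + (2c₂ + c₄)|x|². Moreover, Q ∈ 𝒜 attains the first infimum if and only if x = Qν attains the second and, in the orthonormal basis whose third vector is ν, the 2×2 tangential block of Q equals −((Qν·ν)/2)I₂. -/

import Mathlib

open Matrix

/-- The surface energy `f_s(Q, ν) = c₁ (Qν·ν) + c₂ (Q·Q) + c₃ (Qν·ν)² + c₄ |Qν|²`,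
where `A·B = tr(BᵀA)`. -/
noncomputable def surfE (c₁ c₂ c₃ c₄ : ℝ) (Q : Matrix (Fin 3) (Fin 3) ℝ)
    (ν : Fin 3 → ℝ) : ℝ :=
  c₁ * (Q.mulVec ν ⬝ᵥ ν) + c₂ * (Qᵀ * Q).trace
    + c₃ * (Q.mulVec ν ⬝ᵥ ν) ^ 2 + c₄ * (Q.mulVec ν ⬝ᵥ Q.mulVec ν)

/-- The set `𝒜` of real symmetric traceless 3×3 matrices. -/
def inA (Q : Matrix (Fin 3) (Fin 3) ℝ) : Prop := Q.IsSymm ∧ Q.trace = 0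

/-- The reduced energy `f̃_s(x, ν) = c₁(x·ν) + (c₃ − c₂/2)(x·ν)² + (2c₂ + c₄)|x|²`. -/
noncomputable def redE (c₁ c₂ c₃ c₄ : ℝ) (x ν : Fin 3 → ℝ) : ℝ :=
  c₁ * (x ⬝ᵥ ν) + (c₃ - c₂ / 2) * (x ⬝ᵥ ν) ^ 2 + (2 * c₂ + c₄) * (x ⬝ᵥ x)

/-- The matrix of `𝒜` of least norm among those sending `![0, 0, 1]` to `x`. -/
noncomputable def minimalLift (x : Fin 3 → ℝ) : Matrix (Fin 3) (Fin 3) ℝ :=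
  !![-x 2 / 2, 0, x 0; 0, -x 2 / 2, x 1; x 0, x 1, x 2]

lemma inA_minimalLift (x : Fin 3 → ℝ) : inA (minimalLift x) := by
  refine ⟨?_, ?_⟩
  · ext i j
    fin_cases i <;> fin_cases j <;> simp [minimalLift]
  · simp [minimalLift, Matrix.trace, Fin.sum_univ_three]

lemma minimalLift_mulVec (x : Fin 3 → ℝ) : (minimalLift x).mulVec ![0, 0, 1] = x := by
  ext i
  fin_cases i <;> simp [minimalLift, Matrix.mulVec, dotProduct, Fin.sum_univ_three]

/-- The surface energy exceeds the reduced energy by a sum of squares measuring the distance of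
the tangential block from being a multiple of the identity. -/
lemma surfE_eq_redE_add (c₁ c₂ c₃ c₄ : ℝ) {Q : Matrix (Fin 3) (Fin 3) ℝ} (hQ : inA Q) :
    surfE c₁ c₂ c₃ c₄ Q ![0, 0, 1] = redE c₁ c₂ c₃ c₄ (Q.mulVec ![0, 0, 1]) ![0, 0, 1]
      + c₂ * ((Q 0 0 - Q 1 1) ^ 2 / 2 + 2 * Q 0 1 ^ 2) := by
  obtain ⟨hs, ht⟩ := hQ
  have h10 : Q 1 0 = Q 0 1 := hs.apply 0 1
  have h20 : Q 2 0 = Q 0 2 := hs.apply 0 2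
  have h21 : Q 2 1 = Q 1 2 := hs.apply 1 2
  have h22 : Q 2 2 = -Q 0 0 - Q 1 1 := by
    simp only [Matrix.trace, Matrix.diag, Fin.sum_univ_three] at ht
    linarith
  simp [surfE, redE, Matrix.trace, Matrix.mulVec, dotProduct, Matrix.mul_apply,
    Fin.sum_univ_three, h10, h20, h21, h22]
  ring

lemma redE_le_surfE (c₁ c₃ c₄ : ℝ) {c₂ : ℝ} (h2 : 0 < c₂) {Q : Matrix (Fin 3) (Fin 3) ℝ}
    (hQ : inA Q) :
    redE c₁ c₂ c₃ c₄ (Q.mulVec ![0, 0, 1]) ![0, 0, 1] ≤ surfE c₁ c₂ c₃ c₄ Q ![0, 0, 1] := by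
  rw [surfE_eq_redE_add c₁ c₂ c₃ c₄ hQ]
  exact le_add_of_nonneg_right (by positivity)

lemma surfE_minimalLift (c₁ c₂ c₃ c₄ : ℝ) (x : Fin 3 → ℝ) :
    surfE c₁ c₂ c₃ c₄ (minimalLift x) ![0, 0, 1] = redE c₁ c₂ c₃ c₄ x ![0, 0, 1] := by
  rw [surfE_eq_redE_add c₁ c₂ c₃ c₄ (inA_minimalLift x), minimalLift_mulVec]
  simp [minimalLift]

/-- For `c₂ > 0`, in the (standard) orthonormal basis whose third vector is
`ν = (0,0,1)`: `inf_{Q ∈ 𝒜} f_s(Q,ν) = inf_{x ∈ ℝ³} f̃_s(x,ν)`, and `Q ∈ 𝒜` attains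
the first infimum iff `x = Qν` attains the second and the tangential 2×2 block of `Q`
equals `-((Qν·ν)/2) I₂`. -/
theorem reduction_to_vector_problem (c₁ c₂ c₃ c₄ : ℝ) (h2 : 0 < c₂)
    (ν : Fin 3 → ℝ) (hν : ν = ![0, 0, 1]) :
    sInf {y : ℝ | ∃ Q, inA Q ∧ surfE c₁ c₂ c₃ c₄ Q ν = y} =
      sInf {y : ℝ | ∃ x : Fin 3 → ℝ, redE c₁ c₂ c₃ c₄ x ν = y} ∧
    (∀ Q, inA Q →
      ((∀ Q', inA Q' → surfE c₁ c₂ c₃ c₄ Q ν ≤ surfE c₁ c₂ c₃ c₄ Q' ν) ↔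
        ((∀ x : Fin 3 → ℝ,
            redE c₁ c₂ c₃ c₄ (Q.mulVec ν) ν ≤ redE c₁ c₂ c₃ c₄ x ν) ∧
          Q 0 0 = -(Q.mulVec ν ⬝ᵥ ν) / 2 ∧ Q 1 1 = -(Q.mulVec ν ⬝ᵥ ν) / 2 ∧
          Q 0 1 = 0 ∧ Q 1 0 = 0))) := by
  subst hν
  refine ⟨csInf_eq_csInf_of_forall_exists_le ?_ ?_, fun Q hQ => ⟨fun h => ?_, ?_⟩⟩
  · rintro _ ⟨Q, hQ, rfl⟩
    exact ⟨_, ⟨_, rfl⟩, redE_le_surfE c₁ c₃ c₄ h2 hQ⟩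
  · rintro _ ⟨x, rfl⟩
    exact ⟨_, ⟨_, inA_minimalLift x, rfl⟩, (surfE_minimalLift c₁ c₂ c₃ c₄ x).le⟩
  · have hle (x : Fin 3 → ℝ) := (h _ (inA_minimalLift x)).trans_eq
      (surfE_minimalLift c₁ c₂ c₃ c₄ x)
    refine ⟨fun x => (redE_le_surfE c₁ c₃ c₄ h2 hQ).trans (hle x), ?_⟩
    have hsq : (Q 0 0 - Q 1 1) ^ 2 / 2 + 2 * Q 0 1 ^ 2 ≤ 0 := by
      have := hle (Q.mulVec ![0, 0, 1])
      rw [surfE_eq_redE_add c₁ c₂ c₃ c₄ hQ] at this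
      exact nonpos_of_mul_nonpos_right (by linarith) h2
    have hd : Q 0 0 - Q 1 1 = 0 := by
      apply pow_eq_zero_iff two_ne_zero |>.mp
      linarith [sq_nonneg (Q 0 0 - Q 1 1), sq_nonneg (Q 0 1)]
    have h01 : Q 0 1 = 0 := by
      apply pow_eq_zero_iff two_ne_zero |>.mp
      linarith [sq_nonneg (Q 0 0 - Q 1 1), sq_nonneg (Q 0 1)]
    have hν : Q.mulVec ![0, 0, 1] ⬝ᵥ ![0, 0, 1] = Q 2 2 := by
      simp [Matrix.mulVec, dotProduct, Fin.sum_univ_three]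
    have ht := hQ.2
    simp only [Matrix.trace, Matrix.diag, Fin.sum_univ_three] at ht
    rw [hν]
    exact ⟨by linarith, by linarith, h01, (hQ.1.apply 0 1).trans h01⟩
  · rintro ⟨hmin, h00, h11, h01, -⟩ Q' hQ'
    rw [surfE_eq_redE_add c₁ c₂ c₃ c₄ hQ, h00, h11, h01]
    simpa using (hmin _).trans (redE_le_surfE c₁ c₃ c₄ h2 hQ')
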